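/- For every integer r ≥ 1 and every x ∈ Γ_{2r}, the level set of the Takagi function through x has Hausdorff dimension at least 1/(2r): dim_H(L(τ(x))) ≥ 1/(2r). -/

import Mathlib

open MeasureTheory Set

/-- Distance from a real number to the nearest integer. -/
noncomputable def distNearestInt (t : ℝ) : ℝ := |t - round t|

/-- The Takagi function. -/
noncomputable def takagi (x : ℝ) : ℝ := ∑' n : ℕ, distNearestInt (2 ^ n * x) / 2 ^ n

/-- The `j`-th binary digit of `x ∈ [0,1)` (binary expansion terminating in `0^∞`). -/
noncomputable def bdigit (x : ℝ) (j : ℕ) : ℤ := ⌊(2 : ℝ) ^ j * x⌋ - 2 * ⌊(2 : ℝ) ^ (j - 1) * x⌋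

/-- The deficient digit function `D_j(x) = j - 2(b_1(x) + ⋯ + b_j(x))`. -/
noncomputable def defDigit (x : ℝ) (j : ℕ) : ℤ := (j : ℤ) - 2 * ∑ i ∈ Finset.Icc 1 j, bdigit x i

/-- The deficient digit set `Ω^L`. -/
noncomputable def OmegaL : Set ℝ := {x | x ∈ Set.Ico (0 : ℝ) 1 ∧ ∀ j : ℕ, 1 ≤ j → 0 ≤ defDigit x j}

/-- The set `½Ω^L = {x ∈ [0,1) : D_j(x) > 0 for all j ≥ 1}`. -/
noncomputable def halfOmegaL : Set ℝ :=
  {x | x ∈ Set.Ico (0 : ℝ) 1 ∧ ∀ j : ℕ, 1 ≤ j → 0 < defDigit x j}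

/-- The Takagi singular function. -/
noncomputable def takagiS (x : ℝ) : ℝ := sSup {y | ∃ t ∈ OmegaL, t ≤ x ∧ y = takagi t + t}

/-- `Ω^L_∞`: points of `Ω^L` with infinitely many balance points. -/
noncomputable def OmegaLinf : Set ℝ :=
  {x ∈ OmegaL | {j : ℕ | 1 ≤ j ∧ defDigit x j = 0}.Infinite}

/-- `Ω^L_fin = Ω^L \ Ω^L_∞`. -/
noncomputable def OmegaLfin : Set ℝ := OmegaL \ OmegaLinf

/-- `(m, k)` encodes a member `k / 2^(2m)` of the breakpoint set `ℬ'`. -/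
noncomputable def breakpoint (m k : ℕ) : Prop :=
  (m = 0 ∧ k = 0) ∨
    (1 ≤ m ∧ 0 < k ∧ k < 2 ^ (2 * m) ∧
      (∀ j : ℕ, 1 ≤ j → j ≤ 2 * m - 1 → 0 ≤ defDigit ((k : ℝ) / 2 ^ (2 * m)) j) ∧
      defDigit ((k : ℝ) / 2 ^ (2 * m)) (2 * m) = 0)

/-- The fine partition set `Ω^L(B)` for `B = k / 2^(2m)`. -/
noncomputable def fineSet (m k : ℕ) : Set ℝ :=
  {x | ∃ x' ∈ halfOmegaL, x = (k : ℝ) / 2 ^ (2 * m) + x' / 2 ^ (2 * m)}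

/-- The set `Γ_{2r}`. -/
noncomputable def Gamma (r : ℕ) : Set ℝ :=
  {x | x ∈ Set.Ico (0 : ℝ) 1 ∧ ∀ j : ℕ, 1 ≤ j →
    ((¬ (2 * r ∣ j) → 0 < defDigit x j) ∧ ((2 * r) ∣ j → defDigit x j = 0))}

/-- The level set `L(y)` of the Takagi function. -/
noncomputable def levelSet (y : ℝ) : Set ℝ := {x ∈ Set.Icc (0 : ℝ) 1 | takagi x = y}
lemma dni_add_int (t : ℝ) (m : ℤ) : distNearestInt (t + m) = distNearestInt t := by
  unfold distNearestInt
  rw [round_add_intCast]; push_cast; congr 1; ring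

lemma dni_neg (t : ℝ) : distNearestInt (-t) = distNearestInt t := by
  unfold distNearestInt
  apply le_antisymm
  · have := round_le (-t) (-round t)
    refine this.trans (le_of_eq ?_)
    push_cast; rw [← abs_neg]; congr 1; ring
  · have := round_le t (-round (-t))
    refine this.trans (le_of_eq ?_)
    push_cast; rw [← abs_neg]; congr 1; ring

lemma dni_nonneg (t : ℝ) : 0 ≤ distNearestInt t := abs_nonneg _

lemma dni_le (t : ℝ) : distNearestInt t ≤ 1 / 2 := abs_sub_round t

lemma tk_term_le (x : ℝ) (n : ℕ) : distNearestInt (2 ^ n * x) / 2 ^ n ≤ (1 / 2) * (1 / 2) ^ n := by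
  rw [one_div_pow, div_eq_mul_one_div]
  exact mul_le_mul_of_nonneg_right (dni_le _) (by positivity)

lemma tk_summable (x : ℝ) : Summable fun n : ℕ => distNearestInt (2 ^ n * x) / 2 ^ n :=
  Summable.of_nonneg_of_le (fun n => div_nonneg (dni_nonneg _) (by positivity)) (tk_term_le x)
    (summable_geometric_two.mul_left _)

lemma tk_nonneg (x : ℝ) : 0 ≤ takagi x :=
  tsum_nonneg (fun n => div_nonneg (dni_nonneg _) (by positivity))

lemma tk_le_one (x : ℝ) : takagi x ≤ 1 := by
  unfold takagi
  refine ((tk_summable x).tsum_le_tsum (tk_term_le x) (summable_geometric_two.mul_left _)).trans ?_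
  rw [tsum_mul_left, tsum_geometric_two]; norm_num

lemma tk_rec (x : ℝ) : takagi x = distNearestInt x + takagi (2 * x) / 2 := by
  unfold takagi
  rw [(tk_summable x).tsum_eq_zero_add, ← tsum_div_const]
  congr 1
  · simp
  · congr 1; ext n
    rw [pow_succ, mul_assoc, div_div]

lemma tk_add_int (x : ℝ) (m : ℤ) : takagi (x + m) = takagi x := by
  unfold takagi
  congr 1; ext n
  have : (2 : ℝ) ^ n * (x + m) = 2 ^ n * x + ((2 ^ n * m : ℤ) : ℝ) := by push_cast; ring
  rw [this, dni_add_int]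

lemma tk_neg (x : ℝ) : takagi (-x) = takagi x := by
  unfold takagi
  congr 1; ext n
  rw [mul_neg, dni_neg]

lemma tk_symm (x : ℝ) : takagi (1 - x) = takagi x := by
  have := tk_add_int (-x) 1
  rw [tk_neg] at this
  rw [← this]; congr 1; push_cast; ring

lemma dni_small (t : ℝ) (h0 : 0 ≤ t) (h1 : t ≤ 1 / 2) : distNearestInt t = t := by
  unfold distNearestInt
  apply le_antisymm
  · have := round_le t 0
    simpa [abs_of_nonneg h0] using this
  · rcases le_or_gt (round t) 0 with h | h
    · have : (round t : ℝ) ≤ 0 := by exact_mod_cast h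
      rw [abs_of_nonneg] <;> linarith
    · have : (1 : ℝ) ≤ round t := by exact_mod_cast h
      rw [abs_of_nonpos] <;> linarith

lemma tk_half (u : ℝ) (h0 : 0 ≤ u) (h1 : u ≤ 1) : takagi (u / 2) = u / 2 + takagi u / 2 := by
  rw [tk_rec, dni_small _ (by linarith) (by linarith)]
  congr 3; ring

lemma tk_digit (b : ℤ) (hb : b = 0 ∨ b = 1) (u : ℝ) (h0 : 0 ≤ u) (h1 : u ≤ 1) :
    takagi ((b + u) / 2) = (b + (1 - 2 * b) * u) / 2 + takagi u / 2 := by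
  rcases hb with rfl | rfl
  · simp [tk_half u h0 h1]
  · rw [← tk_symm, show 1 - (((1 : ℤ) : ℝ) + u) / 2 = (1 - u) / 2 by push_cast; ring,
      tk_half _ (by linarith) (by linarith), tk_symm]
    push_cast; ring

lemma bdigit_succ (y : ℝ) (n : ℕ) :
    bdigit y (n + 1) = ⌊(2 : ℝ) ^ (n + 1) * y⌋ - 2 * ⌊(2 : ℝ) ^ n * y⌋ := rfl

lemma bdigit_01 (y : ℝ) (n : ℕ) : bdigit y (n + 1) = 0 ∨ bdigit y (n + 1) = 1 := by
  rw [bdigit_succ]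
  have h1 := Int.floor_le ((2 : ℝ) ^ n * y)
  have h2 := Int.lt_floor_add_one ((2 : ℝ) ^ n * y)
  have h3 : 2 * ⌊(2 : ℝ) ^ n * y⌋ ≤ ⌊(2 : ℝ) ^ (n + 1) * y⌋ := by
    rw [Int.le_floor]; push_cast; rw [pow_succ]; linarith
  have h4 : ⌊(2 : ℝ) ^ (n + 1) * y⌋ < 2 * ⌊(2 : ℝ) ^ n * y⌋ + 2 := by
    rw [Int.floor_lt]; push_cast; rw [pow_succ]; linarith
  omega

lemma defDigit_succ (y : ℝ) (n : ℕ) :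
    defDigit y (n + 1) = defDigit y n + 1 - 2 * bdigit y (n + 1) := by
  unfold defDigit
  rw [Finset.sum_Icc_succ_top (by omega)]; push_cast; ring

lemma defDigit_zero (y : ℝ) : defDigit y 0 = 0 := by simp [defDigit]

lemma tk_affine (y : ℝ) (hy : y ∈ Ico (0 : ℝ) 1) (n : ℕ) :
    ∃ c : ℝ, ∀ t ∈ Icc (0 : ℝ) 1, takagi ((⌊(2 : ℝ) ^ n * y⌋ + t) / 2 ^ n)
      = c + (takagi t + defDigit y n * t) / 2 ^ n := by
  induction n with
  | zero =>
    refine ⟨0, fun t _ => ?_⟩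
    rw [defDigit_zero]
    simp [Int.floor_eq_zero_iff.2 hy]
  | succ n ih =>
    obtain ⟨c, hc⟩ := ih
    have hb := bdigit_01 y n
    have hd := bdigit_succ y n
    rw [defDigit_succ]
    set b := bdigit y (n + 1)
    refine ⟨c + ((b : ℝ) / 2 + defDigit y n * b / 2) / 2 ^ n, fun t ht => ?_⟩
    have hf : ⌊(2 : ℝ) ^ (n + 1) * y⌋ = 2 * ⌊(2 : ℝ) ^ n * y⌋ + b := by omega
    have hb' : (0 : ℝ) ≤ b ∧ (b : ℝ) ≤ 1 := by rcases hb with h | h <;> rw [h] <;> norm_num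
    have e : (((⌊(2 : ℝ) ^ (n + 1) * y⌋ : ℤ) : ℝ) + t) / 2 ^ (n + 1)
        = (⌊(2 : ℝ) ^ n * y⌋ + (b + t) / 2) / 2 ^ n := by
      rw [hf]; push_cast; field_simp; ring
    rw [e, hc _ ⟨by linarith [ht.1], by linarith [ht.2]⟩, tk_digit b hb t ht.1 ht.2]
    push_cast; field_simp; ring

lemma bdigit_shift (x : ℝ) (m j : ℕ) :
    bdigit (Int.fract ((2 : ℝ) ^ m * x)) (j + 1) = bdigit x (m + j + 1) := by
  rw [bdigit_succ, bdigit_succ]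
  have key : ∀ i : ℕ, ⌊(2 : ℝ) ^ i * Int.fract ((2 : ℝ) ^ m * x)⌋
      = ⌊(2 : ℝ) ^ (m + i) * x⌋ - 2 ^ i * ⌊(2 : ℝ) ^ m * x⌋ := by
    intro i
    rw [← Int.floor_sub_intCast]
    congr 1
    unfold Int.fract
    push_cast; ring
  rw [key, key, add_assoc]; ring

lemma defDigit_shift (x : ℝ) (m j : ℕ) :
    defDigit (Int.fract ((2 : ℝ) ^ m * x)) j = defDigit x (m + j) - defDigit x m := by
  induction j with
  | zero => simp [defDigit_zero]
  | succ j ih => rw [defDigit_succ, ih, bdigit_shift, ← add_assoc, defDigit_succ]; ring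

lemma gamma_shift (r : ℕ) (x : ℝ) (hx : x ∈ Gamma r) (hr : 1 ≤ r) :
    Int.fract ((2 : ℝ) ^ (2 * r) * x) ∈ Gamma r := by
  have h0 := (hx.2 (2 * r) (by omega)).2 dvd_rfl
  refine ⟨⟨Int.fract_nonneg _, Int.fract_lt_one _⟩, fun j hj => ?_⟩
  rw [defDigit_shift, h0, sub_zero]
  have := hx.2 (2 * r + j) (by omega)
  rwa [Nat.dvd_add_right dvd_rfl] at this

lemma gamma_block (r : ℕ) (hr : 1 ≤ r) (y : ℝ) (hy : y ∈ Gamma r) :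
    1 ≤ ⌊(2 : ℝ) ^ (2 * r) * y⌋ ∧ (⌊(2 : ℝ) ^ (2 * r) * y⌋ : ℝ) * 2 ≤ 2 ^ (2 * r) - 2 := by
  obtain ⟨hy0, hy⟩ := hy
  have hD := (hy (2 * r) (by omega)).2 dvd_rfl
  constructor
  · by_contra hcon
    push Not at hcon
    have hz : ⌊(2 : ℝ) ^ (2 * r) * y⌋ < 1 := hcon
    rw [Int.floor_lt] at hz
    have : ∀ j ≤ 2 * r, defDigit y j = j := by
      have fl : ∀ j ≤ 2 * r, ⌊(2 : ℝ) ^ j * y⌋ = 0 := by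
        intro j hj
        rw [Int.floor_eq_zero_iff]
        refine ⟨mul_nonneg (by positivity) hy0.1, lt_of_le_of_lt (b := (2 : ℝ) ^ (2 * r) * y) ?_ (by simpa using hz)⟩
        exact mul_le_mul_of_nonneg_right (pow_le_pow_right₀ (by norm_num : (1 : ℝ) ≤ 2) hj) hy0.1
      intro j
      induction j with
      | zero => simp [defDigit_zero]
      | succ j ih =>
        intro hj
        rw [defDigit_succ, ih (by omega), bdigit_succ, fl _ hj, fl _ (by omega)]
        push_cast; ring
    have := this (2 * r) le_rfl
    omega
  · have h1 := (hy 1 le_rfl).1 (by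
      intro h; have := Nat.le_of_dvd one_pos h; omega)
    have e : defDigit y 1 = 1 - 2 * ⌊2 * y⌋ := by
      rw [defDigit_succ, defDigit_zero, bdigit_succ]
      simp [Int.floor_eq_zero_iff.2 hy0]
    have h2 : ⌊2 * y⌋ < 1 := by omega
    rw [Int.floor_lt] at h2
    push_cast at h2
    have h3 : ⌊(2 : ℝ) ^ (2 * r) * y⌋ < 2 ^ (2 * r - 1) := by
      rw [Int.floor_lt]
      push_cast
      have : (2 : ℝ) ^ (2 * r) = 2 ^ (2 * r - 1) * 2 := by
        rw [← pow_succ]; congr 1; omega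
      rw [this, mul_assoc]
      exact mul_lt_of_lt_one_right (by positivity) h2
    have h4 : (⌊(2 : ℝ) ^ (2 * r) * y⌋ : ℝ) ≤ 2 ^ (2 * r - 1) - 1 := by
      have : ⌊(2 : ℝ) ^ (2 * r) * y⌋ ≤ 2 ^ (2 * r - 1) - 1 := by omega
      exact_mod_cast this
    have : (2 : ℝ) ^ (2 * r) = 2 ^ (2 * r - 1) * 2 := by
      rw [← pow_succ]; congr 1; omega
    linarith

/-- Core: digits w k with flipping. -/
lemma tk_blockAffine (r : ℕ) (hr : 1 ≤ r) (y : ℝ) (hy : y ∈ Gamma r) :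
    ∃ c : ℝ, ∀ t ∈ Icc (0 : ℝ) 1, takagi ((⌊(2 : ℝ) ^ (2 * r) * y⌋ + t) / 2 ^ (2 * r))
      = c + takagi t / 2 ^ (2 * r) := by
  obtain ⟨c, hc⟩ := tk_affine y hy.1 (2 * r)
  refine ⟨c, fun t ht => ?_⟩
  rw [hc t ht, (hy.2 (2 * r) (by omega)).2 dvd_rfl]; simp

noncomputable def ytail (r : ℕ) (x : ℝ) : ℕ → ℝ
  | 0 => x
  | k + 1 => Int.fract ((2 : ℝ) ^ (2 * r) * ytail r x k)

lemma ytail_mem (r : ℕ) (hr : 1 ≤ r) (x : ℝ) (hx : x ∈ Gamma r) (k : ℕ) : ytail r x k ∈ Gamma r := by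
  induction k with
  | zero => exact hx
  | succ k ih => exact gamma_shift r _ ih hr

noncomputable def wdig (r : ℕ) (x : ℝ) (k : ℕ) : ℝ := (⌊(2 : ℝ) ^ (2 * r) * ytail r x k⌋ : ℤ)

noncomputable def fdig (r : ℕ) (x : ℝ) (e : ℕ → Fin 2) (k : ℕ) : ℝ :=
  if e k = 0 then wdig r x k else 2 ^ (2 * r) - 1 - wdig r x k

noncomputable def fX (r : ℕ) (x : ℝ) (e : ℕ → Fin 2) (k : ℕ) : ℝ :=
  ∑' j : ℕ, fdig r x e (j + k) * ((2 ^ (2 * r) : ℝ)⁻¹) ^ (j + 1)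

lemma M_ge (r : ℕ) (hr : 1 ≤ r) : (4 : ℝ) ≤ 2 ^ (2 * r) := by
  calc (4 : ℝ) = 2 ^ 2 := by norm_num
    _ ≤ _ := pow_le_pow_right₀ (by norm_num) (by omega)

lemma wdig_bd (r : ℕ) (hr : 1 ≤ r) (x : ℝ) (hx : x ∈ Gamma r) (k : ℕ) :
    1 ≤ wdig r x k ∧ wdig r x k * 2 ≤ 2 ^ (2 * r) - 2 := by
  have h := gamma_block r hr _ (ytail_mem r hr x hx k)
  exact ⟨by unfold wdig; exact_mod_cast h.1, h.2⟩

lemma fdig_bd (r : ℕ) (hr : 1 ≤ r) (x : ℝ) (hx : x ∈ Gamma r) (e : ℕ → Fin 2) (k : ℕ) :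
    1 ≤ fdig r x e k ∧ fdig r x e k ≤ 2 ^ (2 * r) - 2 := by
  have h := wdig_bd r hr x hx k
  have := M_ge r hr
  unfold fdig
  split_ifs <;> constructor <;> linarith

lemma geo_hasSum (M a : ℝ) (hM : 4 ≤ M) : HasSum (fun j : ℕ => a * (M⁻¹) ^ (j + 1)) (a / (M - 1)) := by
  have h := (hasSum_geometric_of_lt_one (r := M⁻¹) (by positivity)
    (inv_lt_one_of_one_lt₀ (by linarith))).mul_left (a * M⁻¹)
  have e : a * M⁻¹ * (1 - M⁻¹)⁻¹ = a / (M - 1) := by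
    have : M - 1 ≠ 0 := by linarith
    have : M ≠ 0 := by linarith
    have : 1 - M⁻¹ ≠ 0 := by
      have := inv_lt_one_of_one_lt₀ (show 1 < M by linarith)
      linarith
    field_simp
  rw [e] at h
  have e2 : (fun j : ℕ => a * (M⁻¹) ^ (j + 1)) = fun j : ℕ => a * M⁻¹ * (M⁻¹) ^ j := by
    ext j; rw [pow_succ]; ring
  rw [e2]; exact h

lemma fX_summable (r : ℕ) (hr : 1 ≤ r) (x : ℝ) (hx : x ∈ Gamma r) (e : ℕ → Fin 2) (k : ℕ) :
    Summable fun j : ℕ => fdig r x e (j + k) * ((2 ^ (2 * r) : ℝ)⁻¹) ^ (j + 1) := by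
  refine Summable.of_nonneg_of_le (fun j => ?_) (fun j => ?_)
    (geo_hasSum (2 ^ (2 * r)) (2 ^ (2 * r) - 2) (M_ge r hr)).summable
  · exact mul_nonneg (by linarith [(fdig_bd r hr x hx e (j + k)).1]) (by positivity)
  · exact mul_le_mul_of_nonneg_right (fdig_bd r hr x hx e (j + k)).2 (by positivity)

lemma fX_bd (r : ℕ) (hr : 1 ≤ r) (x : ℝ) (hx : x ∈ Gamma r) (e : ℕ → Fin 2) (k : ℕ) :
    1 / (2 ^ (2 * r) - 1) ≤ fX r x e k ∧ fX r x e k ≤ 1 - 1 / (2 ^ (2 * r) - 1) := by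
  have hs := (fX_summable r hr x hx e k).hasSum
  have hM := M_ge r hr
  constructor
  · exact hasSum_le (fun j => mul_le_mul_of_nonneg_right (fdig_bd r hr x hx e (j + k)).1
      (by positivity)) (geo_hasSum (2 ^ (2 * r)) 1 hM) hs
  · have := hasSum_le (fun j => mul_le_mul_of_nonneg_right (fdig_bd r hr x hx e (j + k)).2
      (by positivity)) hs (geo_hasSum (2 ^ (2 * r)) (2 ^ (2 * r) - 2) hM)
    refine this.trans (le_of_eq ?_)
    have : (2 : ℝ) ^ (2 * r) - 1 ≠ 0 := by linarith
    field_simp; ring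

lemma fX_Icc (r : ℕ) (hr : 1 ≤ r) (x : ℝ) (hx : x ∈ Gamma r) (e : ℕ → Fin 2) (k : ℕ) :
    fX r x e k ∈ Icc (0 : ℝ) 1 := by
  have h := fX_bd r hr x hx e k
  have hM := M_ge r hr
  have : 0 < 1 / ((2 : ℝ) ^ (2 * r) - 1) := by
    apply one_div_pos.2; linarith
  constructor <;> linarith

lemma fX_rec (r : ℕ) (hr : 1 ≤ r) (x : ℝ) (hx : x ∈ Gamma r) (e : ℕ → Fin 2) (k : ℕ) :
    fX r x e k = (fdig r x e k + fX r x e (k + 1)) / 2 ^ (2 * r) := by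
  have h := (fX_summable r hr x hx e k).tsum_eq_zero_add
  unfold fX
  rw [h, add_div, ← tsum_div_const]
  congr 1
  · simp; rfl
  · congr 1; ext j
    rw [show j + 1 + k = j + (k + 1) by ring, pow_succ _ (j + 1)]
    ring

lemma tk_fX_step (r : ℕ) (hr : 1 ≤ r) (x : ℝ) (hx : x ∈ Gamma r) (e : ℕ → Fin 2) (k : ℕ) :
    takagi (fX r x e k) - takagi (ytail r x k)
      = (takagi (fX r x e (k + 1)) - takagi (ytail r x (k + 1))) / 2 ^ (2 * r) := by
  obtain ⟨c, hc⟩ := tk_blockAffine r hr _ (ytail_mem r hr x hx k)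
  have hy1 : ytail r x k = (wdig r x k + ytail r x (k + 1)) / 2 ^ (2 * r) := by
    have : wdig r x k + ytail r x (k + 1) = 2 ^ (2 * r) * ytail r x k := by
      unfold wdig; rw [ytail]; exact Int.floor_add_fract _
    rw [this]; field_simp
  have h1 := hc _ ⟨(ytail_mem r hr x hx (k + 1)).1.1, (ytail_mem r hr x hx (k + 1)).1.2.le⟩
  have hI := fX_Icc r hr x hx e (k + 1)
  change takagi ((wdig r x k + _) / _) = _ at h1
  rw [← hy1] at h1
  have h2 : takagi (fX r x e k) = c + takagi (fX r x e (k + 1)) / 2 ^ (2 * r) := by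
    rw [fX_rec r hr x hx e k]
    unfold fdig
    split_ifs with h
    · exact hc _ hI
    · have h3 := hc (1 - fX r x e (k + 1)) ⟨by linarith [hI.2], by linarith [hI.1]⟩
      rw [tk_symm] at h3
      rw [← h3, ← tk_symm]
      congr 1
      change _ = (wdig r x k + _) / _
      field_simp; ring
  rw [h1, h2]; ring

lemma tk_fX (r : ℕ) (hr : 1 ≤ r) (x : ℝ) (hx : x ∈ Gamma r) (e : ℕ → Fin 2) :
    takagi (fX r x e 0) = takagi x := by
  have hM := M_ge r hr
  have key : ∀ k, takagi (fX r x e 0) - takagi (ytail r x 0)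
      = (takagi (fX r x e k) - takagi (ytail r x k)) * ((2 ^ (2 * r) : ℝ)⁻¹) ^ k := by
    intro k
    induction k with
    | zero => simp
    | succ k ih => rw [ih, tk_fX_step r hr x hx e k, pow_succ']; ring
  have lim : Filter.Tendsto (fun k : ℕ => ((2 ^ (2 * r) : ℝ)⁻¹) ^ k) Filter.atTop (nhds 0) :=
    tendsto_pow_atTop_nhds_zero_of_lt_one (by positivity) (inv_lt_one_of_one_lt₀ (by linarith))
  have hb : ∀ k : ℕ, |takagi (fX r x e 0) - takagi (ytail r x 0)| ≤ ((2 ^ (2 * r) : ℝ)⁻¹) ^ k := by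
    intro k
    rw [key k, abs_mul, abs_of_nonneg (a := _ ^ k) (by positivity)]
    refine mul_le_of_le_one_left (by positivity) ?_
    rw [abs_le]
    constructor <;> linarith [tk_nonneg (fX r x e k), tk_le_one (fX r x e k),
      tk_nonneg (ytail r x k), tk_le_one (ytail r x k)]
  have := ge_of_tendsto' lim hb
  exact sub_eq_zero.1 (abs_nonpos_iff.1 this)

lemma fX_gap (r : ℕ) (hr : 1 ≤ r) (x : ℝ) (hx : x ∈ Gamma r) (e e' : ℕ → Fin 2) (k : ℕ)
    (hne : e k ≠ e' k) :
    2 / (2 ^ (2 * r) - 1) / 2 ^ (2 * r) ≤ |fX r x e k - fX r x e' k| := by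
  have h1 := fX_bd r hr x hx e (k + 1)
  have h2 := fX_bd r hr x hx e' (k + 1)
  have hw := wdig_bd r hr x hx k
  have hM : (0 : ℝ) < 2 ^ (2 * r) := by positivity
  rw [fX_rec r hr x hx e k, fX_rec r hr x hx e' k, ← sub_div, abs_div, abs_of_pos hM]
  apply div_le_div_of_nonneg_right _ hM.le
  have e2 : 2 / ((2 : ℝ) ^ (2 * r) - 1) = 2 * (1 / (2 ^ (2 * r) - 1)) := by ring
  rw [e2]
  rw [le_abs]
  unfold fdig
  by_cases h : e k = 0
  · have h' : e' k ≠ 0 := fun h' => hne (h.trans h'.symm)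
    rw [if_pos h, if_neg h']
    right; linarith
  · have h' : e' k = 0 := by
      have := (e k).isLt; have := (e' k).isLt
      omega
    rw [if_neg h, if_pos h']
    left; linarith

lemma fX_prefix (r : ℕ) (hr : 1 ≤ r) (x : ℝ) (hx : x ∈ Gamma r) (e e' : ℕ → Fin 2) (k : ℕ)
    (h : ∀ i < k, e i = e' i) :
    fX r x e 0 - fX r x e' 0 = (fX r x e k - fX r x e' k) / (2 ^ (2 * r)) ^ k := by
  induction k with
  | zero => simp
  | succ k ih =>
    rw [ih (fun i hi => h i (by omega)), fX_rec r hr x hx e k, fX_rec r hr x hx e' k]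
    have : fdig r x e k = fdig r x e' k := by unfold fdig; rw [h k (by omega)]
    rw [this]; field_simp; ring

lemma fX_holder (r : ℕ) (hr : 1 ≤ r) (x : ℝ) (hx : x ∈ Gamma r) :
    ∃ C : NNReal, ∀ e e' : ℕ → Fin 2, |Real.ofDigits e - Real.ofDigits e'|
      ≤ C * |fX r x e 0 - fX r x e' 0| ^ (1 / (2 * r) : ℝ) := by
  have hM := M_ge r hr
  have hr' : (0 : ℝ) < r := by exact_mod_cast hr
  set c : ℝ := 2 / (2 ^ (2 * r) - 1) / 2 ^ (2 * r) with hc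
  have hcpos : 0 < c := by
    apply div_pos (div_pos two_pos (by linarith)) (by positivity)
  refine ⟨⟨(c ^ (1 / (2 * r) : ℝ))⁻¹, by positivity⟩, fun e e' => ?_⟩
  by_cases hee : e = e'
  · subst hee
    rw [sub_self, abs_zero]
    exact mul_nonneg (NNReal.coe_nonneg _) (Real.rpow_nonneg (abs_nonneg _) _)
  · have hex : ∃ k, e k ≠ e' k := Function.ne_iff.1 hee
    classical
    set k := Nat.find hex
    have hk : e k ≠ e' k := Nat.find_spec hex
    have hlt : ∀ i < k, e i = e' i := fun i hi => not_not.1 (Nat.find_min hex hi)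
    have h1 := Real.abs_ofDigits_sub_ofDigits_le hlt
    refine h1.trans ?_
    have h2 : c * ((2 ^ (2 * r)) ^ k)⁻¹ ≤ |fX r x e 0 - fX r x e' 0| := by
      rw [fX_prefix r hr x hx e e' k hlt, abs_div, abs_of_pos (a := ((2 : ℝ) ^ (2 * r)) ^ k)
        (by positivity), div_eq_mul_inv]
      exact mul_le_mul_of_nonneg_right (fX_gap r hr x hx e e' k hk) (by positivity)
    have h3 := Real.rpow_le_rpow (by positivity) h2 (show (0 : ℝ) ≤ 1 / (2 * r) by positivity)
    rw [Real.mul_rpow hcpos.le (by positivity)] at h3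
    have h4 : (((2 ^ (2 * r) : ℝ) ^ k)⁻¹) ^ (1 / (2 * r) : ℝ) = (((2 : ℕ) : ℝ) ^ k)⁻¹ := by
      rw [Real.inv_rpow (by positivity), ← pow_mul, mul_comm (2 * r) k, pow_mul]
      congr 1
      have := Real.pow_rpow_inv_natCast (x := (2 : ℝ) ^ k) (n := 2 * r) (by positivity) (by omega)
      push_cast at this
      rw [one_div, this]; norm_num
    rw [h4] at h3
    have hcp : 0 < c ^ (1 / (2 * r) : ℝ) := by positivity
    change _ ≤ (c ^ (1 / (2 * r) : ℝ))⁻¹ * _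
    rw [le_inv_mul_iff₀ hcp]
    exact h3

/-- For every `x ∈ Γ_{2r}`, the level set through `x` has Hausdorff dimension
at least `1/(2r)`. -/
theorem dimH_levelSet_ge_of_mem_Gamma (r : ℕ) (hr : 1 ≤ r) (x : ℝ) (hx : x ∈ Gamma r) :
    ENNReal.ofReal (1 / (2 * r : ℝ)) ≤ dimH (levelSet (takagi x)) := by
  obtain ⟨C, hC⟩ := fX_holder r hr x hx
  have hr' : (0 : ℝ) < r := by exact_mod_cast hr
  set p : NNReal := ⟨1 / (2 * r : ℝ), by positivity⟩ with hp
  have hp0 : 0 < p := by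
    rw [← NNReal.coe_pos]; change (0 : ℝ) < 1 / (2 * r : ℝ); positivity
  set S : Set ℝ := range fun e : ℕ → Fin 2 => fX r x e 0 with hS
  have hsub : S ⊆ levelSet (takagi x) := by
    rintro _ ⟨e, rfl⟩
    exact ⟨fX_Icc r hr x hx e 0, tk_fX r hr x hx e⟩
  set F : ℝ → ℝ := fun s => Real.ofDigits (Function.invFun (fun e : ℕ → Fin 2 => fX r x e 0) s)
  have hF : ∀ e : ℕ → Fin 2, F (fX r x e 0) = Real.ofDigits e := by
    intro e
    have h1 : fX r x (Function.invFun (fun e : ℕ → Fin 2 => fX r x e 0) (fX r x e 0)) 0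
        = fX r x e 0 :=
      Function.invFun_eq (f := fun e : ℕ → Fin 2 => fX r x e 0) ⟨e, rfl⟩
    have h2 := hC (Function.invFun (fun e : ℕ → Fin 2 => fX r x e 0) (fX r x e 0)) e
    rw [h1, sub_self, abs_zero, Real.zero_rpow (by positivity), mul_zero] at h2
    exact sub_eq_zero.1 (abs_nonpos_iff.1 h2)
  have hH : HolderOnWith C p F S := by
    rintro _ ⟨e, rfl⟩ _ ⟨e', rfl⟩
    simp only [hF]
    rw [edist_dist, edist_dist, Real.dist_eq, Real.dist_eq,
      ENNReal.ofReal_rpow_of_nonneg (abs_nonneg _) (NNReal.coe_nonneg p), ← ENNReal.ofReal_coe_nnreal,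
      ← ENNReal.ofReal_mul (NNReal.coe_nonneg C)]
    exact ENNReal.ofReal_le_ofReal (hC e e')
  have him : Icc (0 : ℝ) 1 ⊆ F '' S := by
    intro y hy
    obtain ⟨e, -, he⟩ := Real.ofDigits_SurjOn (b := 2) (by norm_num) hy
    exact ⟨_, ⟨e, rfl⟩, (hF e).trans he⟩
  have h1 : dimH (Icc (0 : ℝ) 1) = 1 := by
    rw [Real.dimH_of_nonempty_interior (by rw [interior_Icc]; exact ⟨1 / 2, by norm_num, by norm_num⟩)]
    simp
  have h2 : (1 : ENNReal) ≤ dimH S / p := by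
    rw [← h1]; exact (dimH_mono him).trans (hH.dimH_image_le hp0)
  rw [ENNReal.le_div_iff_mul_le (Or.inl (by exact_mod_cast hp0.ne')) (Or.inl ENNReal.coe_ne_top),
    one_mul] at h2
  have h3 : ENNReal.ofReal (1 / (2 * r : ℝ)) = p := ENNReal.ofReal_coe_nnreal (p := p)
  rw [h3]
  exact h2.trans (dimH_mono hsub)
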